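/- Let M̃ be the five-element monoid and S the four-element left M̃-set with η : S → {0,1} as described. There is no family of elements m(x, y, z) ∈ S, defined for all x, y, z ∈ S with η(x) = η(y) = η(z), satisfying all of: η(m(x,y,z)) = η(z); m(x,y,y) = x and m(y,y,z) = z whenever defined; associativity m(u, v, m(x,y,z)) = m(m(u,v,x), y, z) whenever η(u) = η(v) = η(x) = η(y) = η(z); and M̃-equivariance u·m(x,y,z) = m(u·x, u·y, u·z) for all u ∈ M̃ and all x, y, z with η(x) = η(y) = η(z). -/

import Mathlib

/-- The five-element monoid `M̃ = {1, a, b, c, d}`. -/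
inductive M5 : Type
  | one | a | b | c | d
deriving DecidableEq

/-- Multiplication of `M̃`: `1` is the unit, and for `x ≠ 1`,
`x·y = a` if `y ∈ {a, b}` and `x·y = d` if `y ∈ {c, d}`. -/
def M5.mul : M5 → M5 → M5
  | .one, y => y
  | x, .one => x
  | _, .a => .a
  | _, .b => .a
  | _, .c => .d
  | _, .d => .d

/-- The four-element left `M̃`-set `S = {e, s, c', d'}`. -/
inductive S4 : Type
  | e | s | c' | d'
deriving DecidableEq

/-- The left action of `M̃` on `S`: `1` acts as the identity, and for
`x ∈ {a, b, c, d}`: `a·e = b·e = s`, `c·e = c'`, `d·e = d'`, `x·s = s`,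
`x·c' = d'`, `x·d' = d'`. -/
def M5.act : M5 → S4 → S4
  | .one, t => t
  | .a, .e => .s
  | .b, .e => .s
  | .c, .e => .c'
  | .d, .e => .d'
  | _, .s => .s
  | _, .c' => .d'
  | _, .d' => .d'

/-- The equivariant map `η : S → {0, 1}` over the two-element monoid:
`η e = 1` and `η s = η c' = η d' = 0` (here `true` plays the role of `1`). -/
def S4.eta : S4 → Bool
  | .e => true
  | _ => false

/-- There is no fiberwise (over `η`) Maltsev operation on the `M̃`-set `S` which is
associative and `M̃`-equivariant. -/
theorem no_equivariant_maltsev :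
    ¬ ∃ m : S4 → S4 → S4 → S4,
      (∀ x y z : S4, x.eta = y.eta → y.eta = z.eta → (m x y z).eta = z.eta) ∧
      (∀ x y : S4, x.eta = y.eta → m x y y = x) ∧
      (∀ y z : S4, y.eta = z.eta → m y y z = z) ∧
      (∀ u v x y z : S4, u.eta = v.eta → v.eta = x.eta → x.eta = y.eta →
        y.eta = z.eta → m u v (m x y z) = m (m u v x) y z) ∧
      (∀ (u : M5) (x y z : S4), x.eta = y.eta → y.eta = z.eta →
        u.act (m x y z) = m (u.act x) (u.act y) (u.act z)) := by
  rintro ⟨m, h_eta, h_right, h_left, h_assoc, h_act⟩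
  have h_fiber : (m .s .d' .c').eta = false := h_eta .s .d' .c' rfl rfl
  have h_image : M5.a.act (m .s .d' .c') = .s :=
    (h_act .a .s .d' .c' rfl rfl).trans (h_right .s .d' rfl)
  have h_value : m .s .d' .c' = .s := by
    revert h_fiber h_image
    cases m .s .d' .c' <;> decide
  have h := h_assoc .d' .s .s .d' .c' rfl rfl rfl rfl
  rw [h_value, h_right .d' .s rfl, h_left .d' .c' rfl] at h
  cases h
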